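/- arXiv:1802.10303 — 6 statements merged into one kernel-verified Lean document; each statement's English description precedes it below -/
import Mathlib

section
/- Let d be a positive integer, D a finite set of points in ℝ^d, and t ∈ D, with rank_w(t) = 1 + |{s ∈ D : ⟨w,s⟩ > ⟨w,t⟩}|. Let w₁, …, w_m ∈ ℝ^d and let k₁, …, k_m be positive integers with rank_{w_i}(t) ≤ k_i for each i. Then for every nonnegative combination w = Σ_{i=1}^m λ_i w_i with all λ_i ≥ 0 (in particular for every w in the convex hull of {w₁, …, w_m}), rank_w(t) ≤ 1 + Σ_{i=1}^m (k_i − 1). (Generalization of Theorem 1 to m functions, used in the analysis of the MDRC algorithm: points outranking t at any nonnegative combination already outrank t at one of the w_i.) -/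
open scoped Classical

/-- Dot-product score of point `s` under weight vector `w`. -/
noncomputable def dotp {d : ℕ} (w s : Fin d → ℝ) : ℝ := ∑ i, w i * s i

/-- `rankOf D w t = 1 + |{s ∈ D : ⟨w,s⟩ > ⟨w,t⟩}|`. -/
noncomputable def rankOf {d : ℕ} (D : Finset (Fin d → ℝ)) (w t : Fin d → ℝ) : ℕ :=
  1 + (D.filter (fun s => dotp w s > dotp w t)).card

theorem dotp_sum_smul {d m : ℕ} (w : Fin m → Fin d → ℝ) (lam : Fin m → ℝ) (s : Fin d → ℝ) :
    dotp (∑ i, lam i • w i) s = ∑ i, lam i * dotp (w i) s := by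
  simp only [dotp, Finset.sum_apply, Pi.smul_apply, smul_eq_mul, Finset.sum_mul, Finset.mul_sum,
    mul_assoc]
  exact Finset.sum_comm

theorem exists_dotp_gt_of_dotp_sum_smul_gt {d m : ℕ} {w : Fin m → Fin d → ℝ} {lam : Fin m → ℝ}
    (hlam : ∀ i, 0 ≤ lam i) {s t : Fin d → ℝ}
    (hs : dotp (∑ i, lam i • w i) s > dotp (∑ i, lam i • w i) t) :
    ∃ i, dotp (w i) s > dotp (w i) t := by
  by_contra! hle
  rw [dotp_sum_smul, dotp_sum_smul] at hs
  exact hs.not_ge (Finset.sum_le_sum fun i _ => mul_le_mul_of_nonneg_left (hle i) (hlam i))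

theorem stmt_2 {d m : ℕ} (hd : 0 < d) (D : Finset (Fin d → ℝ)) (t : Fin d → ℝ) (ht : t ∈ D)
    (w : Fin m → Fin d → ℝ) (k : Fin m → ℕ) (hk : ∀ i, 0 < k i)
    (h : ∀ i, rankOf D (w i) t ≤ k i)
    (lam : Fin m → ℝ) (hlam : ∀ i, 0 ≤ lam i) :
    rankOf D (∑ i, lam i • w i) t ≤ 1 + ∑ i, (k i - 1) := by
  have hsub : D.filter (fun s => dotp (∑ i, lam i • w i) s > dotp (∑ i, lam i • w i) t) ⊆
      Finset.univ.biUnion fun i => D.filter (fun s => dotp (w i) s > dotp (w i) t) := by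
    intro s hs
    rw [Finset.mem_filter] at hs
    obtain ⟨i, hi⟩ := exists_dotp_gt_of_dotp_sum_smul_gt hlam hs.2
    exact Finset.mem_biUnion.2 ⟨i, Finset.mem_univ i, Finset.mem_filter.2 ⟨hs.1, hi⟩⟩
  refine Nat.add_le_add_left ((Finset.card_le_card hsub).trans
    (Finset.card_biUnion_le.trans (Finset.sum_le_sum fun i _ => ?_))) 1
  have hi := h i
  unfold rankOf at hi
  omega
end

section
/- Let d be a positive integer, D a finite set of points in ℝ^d, t ∈ D, and k a positive integer, with rank_w(t) = 1 + |{s ∈ D : ⟨w,s⟩ > ⟨w,t⟩}|. Let a, b ∈ ℝ^d with a_j ≤ b_j for all j, let B = {w ∈ ℝ^d : a_j ≤ w_j ≤ b_j for all j} be the corresponding axis-aligned box, let m = |{j : a_j < b_j}| be its dimension, and call a point v a corner of B if v_j ∈ {a_j, b_j} for every j. If rank_v(t) ≤ k for every corner v of B, then rank_w(t) ≤ (m+1)·k for every w ∈ B. (This is the geometric core of Theorem mdrc2: a tuple in the top-k of all corners of a hyper-rectangle of the function space of dimension m = d−1 has rank at most d·k for every function inside it.) -/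
open scoped Classical

/-- Every point of an axis-aligned box lies in the convex hull of the corners. -/
lemma mem_convexHull_corners {d : ℕ} {a b w : Fin d → ℝ} (hw : ∀ j, a j ≤ w j ∧ w j ≤ b j) :
    w ∈ convexHull ℝ {v : Fin d → ℝ | ∀ j, v j = a j ∨ v j = b j} := by
  have hset : {v : Fin d → ℝ | ∀ j, v j = a j ∨ v j = b j} =
      Set.univ.pi (fun j => ({a j, b j} : Set ℝ)) := by
    ext v; simp
  rw [hset, convexHull_pi]
  intro j _
  beta_reduce
  rw [convexHull_pair, segment_eq_Icc ((hw j).1.trans (hw j).2)]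
  exact hw j

/-- The corners of a box span an affine subspace of dimension at most that of the box. -/
lemma finrank_vectorSpan_corners_le {d : ℕ} {a b : Fin d → ℝ} (hab : ∀ j, a j ≤ b j) :
    Module.finrank ℝ (vectorSpan ℝ {v : Fin d → ℝ | ∀ j, v j = a j ∨ v j = b j}) ≤
      (Finset.univ.filter (fun j => a j < b j)).card := by
  set S := Finset.univ.filter (fun j => a j < b j)
  let T : Finset (Fin d → ℝ) := S.image (fun j => Pi.single j 1)
  have hle : vectorSpan ℝ {v : Fin d → ℝ | ∀ j, v j = a j ∨ v j = b j} ≤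
      Submodule.span ℝ (T : Set (Fin d → ℝ)) := by
    rw [vectorSpan, Submodule.span_le]
    rintro _ ⟨u, hu, v, hv, rfl⟩
    simp only [vsub_eq_sub, SetLike.mem_coe]
    rw [pi_eq_sum_univ' (u - v)]
    refine Submodule.sum_mem _ fun j _ => ?_
    by_cases hj : a j < b j
    · refine Submodule.smul_mem _ _ (Submodule.subset_span ?_)
      refine Finset.mem_coe.2 (Finset.mem_image.2 ⟨j, by simp [S, hj], ?_⟩)
      ext i
      simp [Pi.single_apply, eq_comm]
    · have hj' : a j = b j := le_antisymm (hab j) (not_lt.1 hj)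
      have huv : u j = v j := by
        rcases hu j with h | h <;> rcases hv j with h' | h' <;> simp [h, h', hj']
      simp [huv]
  calc _ ≤ Module.finrank ℝ (Submodule.span ℝ (T : Set (Fin d → ℝ))) :=
        Submodule.finrank_mono hle
    _ ≤ T.card := finrank_span_finset_le_card T
    _ ≤ S.card := Finset.card_image_le

/-- If `w` is a nonnegative combination of weight vectors `z i`, a point beating `t` under `w`
beats `t` under some `z i`. -/
lemma exists_dotp_lt_of_sum {d : ℕ} {ι : Type*} [Fintype ι] {z : ι → Fin d → ℝ} {c : ι → ℝ}
    (hc : ∀ i, 0 ≤ c i) {w s t : Fin d → ℝ} (hw : ∑ i, c i • z i = w)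
    (h : dotp w t < dotp w s) : ∃ i, dotp (z i) t < dotp (z i) s := by
  by_contra! hn
  have hsum (x : Fin d → ℝ) : dotp w x = ∑ i, c i * dotp (z i) x := by
    simp only [dotp, ← hw, Finset.sum_apply, Pi.smul_apply, smul_eq_mul, Finset.sum_mul,
      Finset.mul_sum, mul_assoc]
    exact Finset.sum_comm
  rw [hsum, hsum] at h
  exact h.not_ge (Finset.sum_le_sum fun i _ => mul_le_mul_of_nonneg_left (hn i) (hc i))

theorem stmt_3 {d : ℕ} (hd : 0 < d) (D : Finset (Fin d → ℝ)) (t : Fin d → ℝ) (ht : t ∈ D)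
    (k : ℕ) (hk : 0 < k)
    (a b : Fin d → ℝ) (hab : ∀ j, a j ≤ b j)
    (m : ℕ) (hm : m = (Finset.univ.filter (fun j => a j < b j)).card)
    (hcorner : ∀ v : Fin d → ℝ, (∀ j, v j = a j ∨ v j = b j) → rankOf D v t ≤ k) :
    ∀ w : Fin d → ℝ, (∀ j, a j ≤ w j ∧ w j ≤ b j) → rankOf D w t ≤ (m + 1) * k := by
  intro w hw
  obtain ⟨ι, _, z, c, hz, hind, hc, -, hsum⟩ :=
    eq_pos_convex_span_of_mem_convexHull (mem_convexHull_corners hw)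
  have hcard : Fintype.card ι ≤ m + 1 := by
    have hmono := Submodule.finrank_mono (vectorSpan_mono ℝ hz)
    have hdim := finrank_vectorSpan_corners_le hab
    have hcard := hind.card_le_finrank_succ
    omega
  have hsub : D.filter (fun s => dotp w s > dotp w t) ⊆
      Finset.univ.biUnion fun i => D.filter (fun s => dotp (z i) s > dotp (z i) t) := by
    intro s hs
    obtain ⟨hsD, hst⟩ := Finset.mem_filter.1 hs
    obtain ⟨i, hi⟩ := exists_dotp_lt_of_sum (fun i => (hc i).le) hsum hst
    exact Finset.mem_biUnion.2 ⟨i, Finset.mem_univ i, Finset.mem_filter.2 ⟨hsD, hi⟩⟩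
  have hbeat : (D.filter (fun s => dotp w s > dotp w t)).card ≤ Fintype.card ι * (k - 1) := by
    refine (Finset.card_le_card hsub).trans (Finset.card_biUnion_le_card_mul _ _ _ fun i _ => ?_)
    have hi := hcorner (z i) (hz ⟨i, rfl⟩)
    unfold rankOf at hi
    omega
  unfold rankOf
  obtain ⟨n, rfl⟩ := Nat.exists_eq_succ_of_ne_zero hk.ne'
  have hmul := hbeat.trans (Nat.mul_le_mul_right _ hcard)
  simp only [Nat.succ_eq_add_one, Nat.add_sub_cancel] at hmul ⊢
  linarith [Nat.mul_succ (m + 1) n]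
end

section
/- Let d be a positive integer, D a finite set of points in ℝ^d, and k an integer with 1 ≤ k ≤ |D|. Let S be a k-set of D with witness (v, c), and let X ⊆ D satisfy X ∩ S = ∅. Then every t ∈ X has rank_v(t) ≥ k + 1, where rank_v(t) = 1 + |{s ∈ D : ⟨v,s⟩ > ⟨v,t⟩}|; in particular X does not have rank-regret at most k for the class of nonnegative linear ranking functions. (Claim of Section 5.2: a subset missing all items of some k-set fails the rank-regret-k requirement.) -/
open scoped Classical

/-- `X` has rank-regret at most `k` for the class of nonnegative linear ranking functions. -/
noncomputable def HasRankRegretAtMost {d : ℕ} (D : Finset (Fin d → ℝ)) (k : ℕ)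
    (X : Finset (Fin d → ℝ)) : Prop :=
  ∀ w : Fin d → ℝ, w ≠ 0 → (∀ i, 0 ≤ w i) → ∃ t ∈ X, rankOf D w t ≤ k

theorem stmt_6 {d : ℕ} (hd : 0 < d) (D : Finset (Fin d → ℝ)) (k : ℕ)
    (hk1 : 1 ≤ k) (hk2 : k ≤ D.card)
    (S : Finset (Fin d → ℝ)) (hSD : S ⊆ D) (hScard : S.card = k)
    (v : Fin d → ℝ) (c : ℝ) (hv : v ≠ 0) (hvnn : ∀ i, 0 ≤ v i)
    (hSv : ∀ p ∈ S, dotp v p > c) (hDv : ∀ p ∈ D \ S, dotp v p < c)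
    (X : Finset (Fin d → ℝ)) (hXD : X ⊆ D) (hXS : X ∩ S = ∅) :
    (∀ t ∈ X, k + 1 ≤ rankOf D v t) ∧ ¬ HasRankRegretAtMost D k X := by
  have key : ∀ t ∈ X, k + 1 ≤ rankOf D v t := by
    intro t ht
    have htS : t ∉ S := fun h => by
      have hmem : t ∈ X ∩ S := Finset.mem_inter.2 ⟨ht, h⟩
      rw [hXS] at hmem
      exact Finset.notMem_empty t hmem
    have htc : dotp v t < c := hDv t (Finset.mem_sdiff.2 ⟨hXD ht, htS⟩)
    have hcard : S.card ≤ (D.filter (fun s => dotp v s > dotp v t)).card :=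
      Finset.card_le_card fun s hs =>
        Finset.mem_filter.2 ⟨hSD hs, htc.trans (hSv s hs)⟩
    unfold rankOf
    omega
  refine ⟨key, fun h => ?_⟩
  obtain ⟨t, ht, hle⟩ := h v hv hvnn
  exact absurd (key t ht) (by omega)
end

section
/- Let d be a positive integer, D a finite set of points in ℝ^d, and k an integer with 1 ≤ k ≤ |D|. For any subset X ⊆ D, the following are equivalent: (i) X has rank-regret at most k, i.e., for every nonzero w ∈ ℝ^d with nonnegative coordinates there exists t ∈ X with rank_w(t) ≤ k; (ii) X is a hitting set for the k-sets of D, i.e., X ∩ S ≠ ∅ for every k-set S of D. (This is the equivalence underlying the mapping of the RRR problem to the geometric hitting set problem in Section 5.2.) -/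
open scoped Classical

/-- `S` is a `k`-set of `D`. -/
noncomputable def IsKSet {d : ℕ} (D : Finset (Fin d → ℝ)) (k : ℕ)
    (S : Finset (Fin d → ℝ)) : Prop :=
  S ⊆ D ∧ S.card = k ∧
    ∃ (v : Fin d → ℝ) (c : ℝ), v ≠ 0 ∧ (∀ i, 0 ≤ v i) ∧
      (∀ p ∈ S, dotp v p > c) ∧ (∀ p ∈ D \ S, dotp v p < c)

open Filter Topology Polynomial

theorem exists_top_subset {α : Type*} [DecidableEq α] (f : α → ℝ) (D : Finset α)
    (hf : Set.InjOn f D) (k : ℕ) (hk : k ≤ D.card) :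
    ∃ S ⊆ D, S.card = k ∧ ∀ q ∈ D \ S, ∀ p ∈ S, f q < f p := by
  induction k with
  | zero => exact ⟨∅, by simp, by simp, by simp⟩
  | succ k ih =>
    obtain ⟨S, hSD, hcard, hS⟩ := ih (by omega)
    have hne : (D \ S).Nonempty := by
      rw [← Finset.card_pos, Finset.card_sdiff_of_subset hSD]
      omega
    obtain ⟨m, hm, hmax⟩ := Finset.exists_max_image (D \ S) f hne
    have hm' := Finset.mem_sdiff.1 hm
    refine ⟨insert m S, Finset.insert_subset hm'.1 hSD, ?_, ?_⟩
    · rw [Finset.card_insert_of_notMem hm'.2, hcard]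
    · intro q hq p hp
      simp only [Finset.mem_sdiff, Finset.mem_insert, not_or] at hq
      have hqS : q ∈ D \ S := Finset.mem_sdiff.2 ⟨hq.1, hq.2.2⟩
      rcases Finset.mem_insert.1 hp with rfl | hp
      · exact lt_of_le_of_ne (hmax q hqS) fun h => hq.2.1 (hf hq.1 hm'.1 h)
      · exact hS q hqS p hp

theorem Polynomial.eventually_eval_ne_zero (P : ℝ[X]) (hP : P ≠ 0) (a : ℝ) :
    ∀ᶠ x in 𝓝[>] a, P.eval x ≠ 0 := by
  have hfin : {x | P.IsRoot x}.Finite := Polynomial.finite_setOfPred_isRoot hP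
  have hcl : ({x | P.IsRoot x} \ {a})ᶜ ∈ 𝓝 a :=
    (hfin.subset Set.sdiff_subset).isClosed.isOpen_compl.mem_nhds (by simp)
  filter_upwards [mem_nhdsWithin_of_mem_nhds hcl, self_mem_nhdsWithin] with x hx hxa h0
  exact hx ⟨h0, ne_of_gt hxa⟩

/-- The weight vector `w` perturbed along the moment curve. -/
noncomputable def perturbedWeight {d : ℕ} (w : Fin d → ℝ) (ε : ℝ) : Fin d → ℝ :=
  fun i => w i + ε ^ (i.val + 1)

theorem continuous_dotp_perturbedWeight {d : ℕ} (w p : Fin d → ℝ) :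
    Continuous fun ε => dotp (perturbedWeight w ε) p := by
  unfold dotp perturbedWeight
  fun_prop

theorem eventually_dotp_perturbedWeight_lt {d : ℕ} (w p q : Fin d → ℝ)
    (h : dotp w p < dotp w q) :
    ∀ᶠ ε in 𝓝[>] (0 : ℝ), dotp (perturbedWeight w ε) p < dotp (perturbedWeight w ε) q := by
  apply Filter.Eventually.filter_mono nhdsWithin_le_nhds
  refine (continuous_dotp_perturbedWeight w p).continuousAt.eventually_lt
    (continuous_dotp_perturbedWeight w q).continuousAt ?_
  have h0 : perturbedWeight w 0 = w := by
    ext i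
    simp [perturbedWeight]
  rwa [h0]

theorem eventually_dotp_perturbedWeight_ne {d : ℕ} (w p q : Fin d → ℝ) (h : p ≠ q) :
    ∀ᶠ ε in 𝓝[>] (0 : ℝ), dotp (perturbedWeight w ε) p ≠ dotp (perturbedWeight w ε) q := by
  obtain ⟨j, hj⟩ := Function.ne_iff.1 h
  let P : ℝ[X] := C (dotp w p - dotp w q) + ∑ i : Fin d, C (p i - q i) * X ^ (i.val + 1)
  have hP : P ≠ 0 := by
    intro h0
    have hc : P.coeff (j.val + 1) = p j - q j := by
      simp only [P, coeff_add, coeff_C_succ, finsetSum_coeff, coeff_C_mul, coeff_X_pow,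
        Nat.add_right_cancel_iff, Fin.val_inj]
      simp
    rw [h0, coeff_zero] at hc
    exact hj (sub_eq_zero.1 hc.symm)
  filter_upwards [P.eventually_eval_ne_zero hP 0] with ε hε heq
  apply hε
  have : P.eval ε = dotp (perturbedWeight w ε) p - dotp (perturbedWeight w ε) q := by
    simp only [P, dotp, perturbedWeight, eval_add, eval_C, eval_finsetSum, eval_mul, eval_pow,
      eval_X, ← Finset.sum_sub_distrib, ← Finset.sum_add_distrib]
    exact Finset.sum_congr rfl fun i _ => by ring
  rw [this, heq, sub_self]

theorem exists_generic_weight {d : ℕ} (D : Finset (Fin d → ℝ)) (w : Fin d → ℝ)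
    (hw : w ≠ 0) (hw0 : ∀ i, 0 ≤ w i) :
    ∃ v : Fin d → ℝ, v ≠ 0 ∧ (∀ i, 0 ≤ v i) ∧ Set.InjOn (dotp v) D ∧
      ∀ p ∈ D, ∀ q ∈ D, dotp w p < dotp w q → dotp v p < dotp v q := by
  have hlt : ∀ᶠ ε in 𝓝[>] (0 : ℝ), ∀ p ∈ D, ∀ q ∈ D, dotp w p < dotp w q →
      dotp (perturbedWeight w ε) p < dotp (perturbedWeight w ε) q := by
    simp only [Filter.eventually_all_finset]
    intro p _ q _
    by_cases h : dotp w p < dotp w q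
    · simpa [h] using eventually_dotp_perturbedWeight_lt w p q h
    · simp [h]
  have hne : ∀ᶠ ε in 𝓝[>] (0 : ℝ), ∀ p ∈ D, ∀ q ∈ D, p ≠ q →
      dotp (perturbedWeight w ε) p ≠ dotp (perturbedWeight w ε) q := by
    simp only [Filter.eventually_all_finset]
    intro p _ q _
    by_cases h : p = q
    · simp [h]
    · simpa [h] using eventually_dotp_perturbedWeight_ne w p q h
  obtain ⟨ε, hε_lt, hε_ne, hε⟩ :=
    (hlt.and (hne.and (self_mem_nhdsWithin : Set.Ioi (0 : ℝ) ∈ 𝓝[>] 0))).exists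
  have hε : 0 < ε := hε
  have hle (i : Fin d) : w i < perturbedWeight w ε i :=
    lt_add_of_pos_right _ (pow_pos hε _)
  refine ⟨perturbedWeight w ε, ?_, fun i => (hw0 i).trans (hle i).le, ?_, hε_lt⟩
  · obtain ⟨i, -⟩ := Function.ne_iff.1 hw
    exact fun h => ((hw0 i).trans_lt (hle i)).ne' (congrFun h i)
  · intro p hp q hq h
    by_contra hpq
    exact hε_ne p hp q hq hpq h

theorem stmt_7 {d : ℕ} (hd : 0 < d) (D : Finset (Fin d → ℝ)) (k : ℕ)
    (hk1 : 1 ≤ k) (hk2 : k ≤ D.card)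
    (X : Finset (Fin d → ℝ)) (hXD : X ⊆ D) :
    HasRankRegretAtMost D k X ↔ ∀ S : Finset (Fin d → ℝ), IsKSet D k S → (X ∩ S).Nonempty := by
  constructor
  · rintro hX S ⟨hSD, hcard, v, c, hv, hv0, hgt, hlt⟩
    obtain ⟨t, htX, ht⟩ := hX v hv hv0
    refine ⟨t, Finset.mem_inter.2 ⟨htX, ?_⟩⟩
    by_contra htS
    have htc := hlt t (Finset.mem_sdiff.2 ⟨hXD htX, htS⟩)
    have hsub : S ⊆ D.filter (fun s => dotp v s > dotp v t) := fun s hs =>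
      Finset.mem_filter.2 ⟨hSD hs, htc.trans (hgt s hs)⟩
    have := Finset.card_le_card hsub
    unfold rankOf at ht
    omega
  · intro hX w hw hw0
    obtain ⟨v, hv, hv0, hinj, hmono⟩ := exists_generic_weight D w hw hw0
    obtain ⟨S, hSD, hcard, hS⟩ := exists_top_subset (dotp v) D hinj k hk2
    obtain ⟨c, hc1, hc2⟩ := Order.exists_between_finsets
      ((D \ S).image (dotp v)) (S.image (dotp v)) (by
        simpa only [Finset.forall_mem_image] using hS)
    rw [Finset.forall_mem_image] at hc1 hc2
    obtain ⟨t, ht⟩ := hX S ⟨hSD, hcard, v, c, hv, hv0, fun p hp => hc2 hp, fun p hp => hc1 hp⟩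
    obtain ⟨htX, htS⟩ := Finset.mem_inter.1 ht
    refine ⟨t, htX, ?_⟩
    have hsub : D.filter (fun s => dotp w s > dotp w t) ⊆ S.erase t := by
      intro s hs
      obtain ⟨hsD, hst⟩ := Finset.mem_filter.1 hs
      have hlt := hmono t (hXD htX) s hsD hst
      refine Finset.mem_erase.2 ⟨fun h => hlt.ne (by rw [h]), ?_⟩
      by_contra hsS
      exact hlt.not_gt (hS s (Finset.mem_sdiff.2 ⟨hsD, hsS⟩) t htS)
    have := Finset.card_le_card hsub
    rw [Finset.card_erase_of_mem htS] at this
    unfold rankOf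
    omega
end

section
/- Let d be a positive integer, D a finite set of points in ℝ^d, and k an integer with 1 ≤ k ≤ |D|. If S is a k-set of D with witness (v, c), then there exists a vector v' ∈ ℝ^d with all coordinates strictly positive such that the score map s ↦ ⟨v', s⟩ is injective on D and S is exactly the set of k points of D with the largest scores under v' (equivalently, S = {t ∈ D : rank_{v'}(t) ≤ k}). (Stability of k-set witnesses under perturbation: every k-set arises as the exact, tie-free top-k of some positive weight vector.) -/
open scoped Classical

open Filter Topology in
/-- A nonzero real polynomial does not vanish at small positive arguments. -/
theorem eventually_eval_ne_zero_nhdsGT {P : Polynomial ℝ} (hP : P ≠ 0) :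
    ∀ᶠ e in 𝓝[>] (0 : ℝ), P.eval e ≠ 0 := by
  have hfin : ({x | P.IsRoot x} \ {0}).Finite :=
    (Polynomial.finite_setOfPred_isRoot hP).subset Set.sdiff_subset
  have hmem : ({x | P.IsRoot x} \ {0})ᶜ ∈ 𝓝 (0 : ℝ) :=
    hfin.isClosed.isOpen_compl.mem_nhds (by simp)
  filter_upwards [mem_nhdsWithin_of_mem_nhds hmem, self_mem_nhdsWithin] with e he hpos h0
  exact he ⟨h0, (Set.mem_Ioi.mp hpos).ne'⟩

/-- Perturbation of `v` along the moment curve. -/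
def momentPerturb {d : ℕ} (v : Fin d → ℝ) (e : ℝ) : Fin d → ℝ :=
  fun i => v i + e ^ ((i : ℕ) + 1)

theorem continuous_dotp_momentPerturb {d : ℕ} (v s : Fin d → ℝ) :
    Continuous fun e => dotp (momentPerturb v e) s := by
  unfold dotp momentPerturb
  fun_prop

theorem momentPerturb_zero {d : ℕ} (v : Fin d → ℝ) : momentPerturb v 0 = v := by
  funext i
  simp [momentPerturb]

open Filter Topology Polynomial in
/-- Small moment-curve perturbations separate any two distinct points. -/
theorem eventually_dotp_momentPerturb_ne {d : ℕ} (v : Fin d → ℝ) {p q : Fin d → ℝ}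
    (hpq : p ≠ q) :
    ∀ᶠ e in 𝓝[>] (0 : ℝ), dotp (momentPerturb v e) p ≠ dotp (momentPerturb v e) q := by
  let P : ℝ[X] := C (dotp v p - dotp v q) + ∑ i : Fin d, C (p i - q i) * X ^ ((i : ℕ) + 1)
  have hP : P ≠ 0 := by
    obtain ⟨j, hj⟩ := Function.ne_iff.mp hpq
    intro h
    have hc : P.coeff ((j : ℕ) + 1) = p j - q j := by
      simp [P, finsetSum_coeff, coeff_X_pow, Fin.val_inj, -map_sub]
    rw [h, coeff_zero] at hc
    exact hj (sub_eq_zero.mp hc.symm)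
  filter_upwards [eventually_eval_ne_zero_nhdsGT hP] with e he heq
  apply he
  have : P.eval e = dotp (momentPerturb v e) p - dotp (momentPerturb v e) q := by
    simp only [P, dotp, momentPerturb, eval_add, eval_C, eval_finsetSum, eval_mul, eval_pow,
      eval_X, ← Finset.sum_sub_distrib, ← Finset.sum_add_distrib]
    exact Finset.sum_congr rfl fun i _ => by ring
  rw [this, heq, sub_self]

/-- A subset scoring strictly above its complement consists of the points of rank at most its
cardinality. -/
theorem eq_filter_rankOf_le_card {d : ℕ} {D S : Finset (Fin d → ℝ)} (hSD : S ⊆ D)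
    {w : Fin d → ℝ} {c : ℝ} (hS : ∀ p ∈ S, c < dotp w p) (hD : ∀ p ∈ D \ S, dotp w p < c) :
    S = D.filter (fun t => rankOf D w t ≤ S.card) := by
  ext t
  rw [Finset.mem_filter]
  constructor
  · intro ht
    refine ⟨hSD ht, ?_⟩
    have hlt : (D.filter (fun s => dotp w s > dotp w t)).card < S.card := by
      apply Finset.card_lt_card
      refine Finset.ssubset_iff_subset_ne.mpr ⟨fun s hs => ?_, fun h => ?_⟩
      · obtain ⟨hsD, hst⟩ := Finset.mem_filter.mp hs
        by_contra hsS
        have h1 := hD s (Finset.mem_sdiff.mpr ⟨hsD, hsS⟩)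
        have h2 := hS t ht
        linarith
      · rw [← h] at ht
        exact lt_irrefl _ (Finset.mem_filter.mp ht).2
    unfold rankOf
    omega
  · rintro ⟨htD, hr⟩
    by_contra htS
    have hle : S.card ≤ (D.filter (fun s => dotp w s > dotp w t)).card := by
      refine Finset.card_le_card fun s hs => Finset.mem_filter.mpr ⟨hSD hs, ?_⟩
      exact (hD t (Finset.mem_sdiff.mpr ⟨htD, htS⟩)).trans (hS s hs)
    unfold rankOf at hr
    omega

open Filter Topology in
theorem stmt_9 {d : ℕ} (hd : 0 < d) (D : Finset (Fin d → ℝ)) (k : ℕ)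
    (hk1 : 1 ≤ k) (hk2 : k ≤ D.card)
    (S : Finset (Fin d → ℝ)) (hSD : S ⊆ D) (hScard : S.card = k)
    (v : Fin d → ℝ) (c : ℝ) (hv : v ≠ 0) (hvnn : ∀ i, 0 ≤ v i)
    (hSv : ∀ p ∈ S, dotp v p > c) (hDv : ∀ p ∈ D \ S, dotp v p < c) :
    ∃ v' : Fin d → ℝ, (∀ i, 0 < v' i) ∧
      Set.InjOn (fun s => dotp v' s) (D : Set (Fin d → ℝ)) ∧
      S = D.filter (fun t => rankOf D v' t ≤ k) := by
  have hlim : ∀ p, Tendsto (fun e => dotp (momentPerturb v e) p) (𝓝[>] 0) (𝓝 (dotp v p)) := by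
    intro p
    have h := (continuous_dotp_momentPerturb v p).tendsto 0
    rw [momentPerturb_zero] at h
    exact h.mono_left nhdsWithin_le_nhds
  have hS : ∀ᶠ e in 𝓝[>] (0 : ℝ), ∀ p ∈ S, c < dotp (momentPerturb v e) p :=
    (eventually_all_finset S).mpr fun p hp => (hlim p).eventually_const_lt (hSv p hp)
  have hD : ∀ᶠ e in 𝓝[>] (0 : ℝ), ∀ p ∈ D \ S, dotp (momentPerturb v e) p < c :=
    (eventually_all_finset (D \ S)).mpr fun p hp => (hlim p).eventually_lt_const (hDv p hp)
  have hne : ∀ᶠ e in 𝓝[>] (0 : ℝ), ∀ p ∈ D, ∀ q ∈ D, p ≠ q →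
      dotp (momentPerturb v e) p ≠ dotp (momentPerturb v e) q := by
    refine (eventually_all_finset D).mpr fun p _ => (eventually_all_finset D).mpr fun q _ => ?_
    by_cases hpq : p = q
    · exact Eventually.of_forall fun e h => absurd hpq h
    · exact (eventually_dotp_momentPerturb_ne v hpq).mono fun e he _ => he
  obtain ⟨e, heS, heD, hene, hpos⟩ :=
    (hS.and (hD.and (hne.and self_mem_nhdsWithin))).exists
  refine ⟨momentPerturb v e, fun i => ?_, fun p hp q hq hpq => ?_, ?_⟩
  · exact add_pos_of_nonneg_of_pos (hvnn i) (pow_pos hpos _)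
  · by_contra h
    exact hene p hp q hq h hpq
  · rw [← hScard]
    exact eq_filter_rankOf_le_card hSD heS heD
end

section
/- Let D be a finite set of points in ℝ², t ∈ D, and k a positive integer. For θ ∈ [0, π/2] write w(θ) = (cos θ, sin θ), and let Θ_t = {θ ∈ [0, π/2] : rank_{w(θ)}(t) ≤ k}, where rank_w(t) = 1 + |{s ∈ D : ⟨w,s⟩ > ⟨w,t⟩}|. If Θ_t is nonempty, then Θ_t is a closed subset of [0, π/2], so it has a minimum b and a maximum e, and for every θ ∈ [b, e] one has rank_{w(θ)}(t) ≤ 2k. (Key lemma behind the 2DRRR algorithm: taking the convex closure of the angles where t is in the top-k at most doubles its rank.) -/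
open scoped Classical

/-- The unit weight vector `(cos θ, sin θ)` in the plane. -/
noncomputable def wvec (θ : ℝ) : Fin 2 → ℝ := ![Real.cos θ, Real.sin θ]

/-- The set of angles `θ ∈ [0, π/2]` for which `t` is in the top-`k` of `D` under `w(θ)`. -/
noncomputable def Theta (D : Finset (Fin 2 → ℝ)) (k : ℕ) (t : Fin 2 → ℝ) : Set ℝ :=
  {θ : ℝ | θ ∈ Set.Icc 0 (Real.pi / 2) ∧ rankOf D (wvec θ) t ≤ k}

lemma dotp_wvec (θ : ℝ) (s : Fin 2 → ℝ) :
    dotp (wvec θ) s = Real.cos θ * s 0 + Real.sin θ * s 1 := by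
  simp [dotp, wvec, Fin.sum_univ_two]

lemma continuous_dotp_wvec (s : Fin 2 → ℝ) : Continuous fun θ => dotp (wvec θ) s := by
  simp only [dotp_wvec]
  fun_prop

/-- The rank of a point is lower semicontinuous in the angle of the weight vector. -/
lemma isClosed_rankOf_le (D : Finset (Fin 2 → ℝ)) (t : Fin 2 → ℝ) (k : ℕ) :
    IsClosed {θ : ℝ | rankOf D (wvec θ) t ≤ k} := by
  rw [← isOpen_compl_iff, isOpen_iff_eventually]
  intro θ hθ
  simp only [Set.mem_compl_iff, Set.mem_ofPred_eq, not_le] at hθ ⊢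
  have hev : ∀ᶠ φ in nhds θ, ∀ s ∈ D.filter (fun s => dotp (wvec θ) s > dotp (wvec θ) t),
      dotp (wvec φ) s > dotp (wvec φ) t := by
    rw [Filter.eventually_all_finset]
    intro s hs
    exact (continuous_dotp_wvec t).continuousAt.eventually_lt
      (continuous_dotp_wvec s).continuousAt (Finset.mem_filter.1 hs).2
  filter_upwards [hev] with φ hφ
  refine hθ.trans_le (Nat.add_le_add_left (Finset.card_le_card fun s hs => ?_) 1)
  exact Finset.mem_filter.2 ⟨(Finset.mem_filter.1 hs).1, hφ s hs⟩

lemma isClosed_Theta (D : Finset (Fin 2 → ℝ)) (k : ℕ) (t : Fin 2 → ℝ) :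
    IsClosed (Theta D k t) :=
  isClosed_Icc.inter (isClosed_rankOf_le D t k)

/-- A point outscoring `t` at an intermediate angle outscores `t` at one of the two endpoints. -/
lemma dotp_wvec_lt_or_lt {b e θ : ℝ} (hbe : e - b < Real.pi) (hθ : θ ∈ Set.Icc b e)
    {s t : Fin 2 → ℝ} (h : dotp (wvec θ) t < dotp (wvec θ) s) :
    dotp (wvec b) t < dotp (wvec b) s ∨ dotp (wvec e) t < dotp (wvec e) s := by
  obtain ⟨h₁, h₂⟩ := hθ
  rcases (h₁.trans h₂).eq_or_lt with rfl | hlt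
  · obtain rfl := le_antisymm h₁ h₂
    exact Or.inl h
  by_contra! hcon
  obtain ⟨hb, he⟩ := hcon
  have hpos : 0 < Real.sin (e - b) := Real.sin_pos_of_pos_of_lt_pi (by linarith) hbe
  have h₃ : 0 ≤ Real.sin (e - θ) :=
    Real.sin_nonneg_of_nonneg_of_le_pi (by linarith) (by linarith)
  have h₄ : 0 ≤ Real.sin (θ - b) :=
    Real.sin_nonneg_of_nonneg_of_le_pi (by linarith) (by linarith)
  have key : ∀ u, Real.sin (e - b) * dotp (wvec θ) u =
      Real.sin (e - θ) * dotp (wvec b) u + Real.sin (θ - b) * dotp (wvec e) u := by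
    intro u
    simp only [dotp_wvec, Real.sin_sub]
    ring
  have := mul_lt_mul_of_pos_left h hpos
  rw [key, key] at this
  linarith [mul_le_mul_of_nonneg_left hb h₃, mul_le_mul_of_nonneg_left he h₄]

lemma rankOf_wvec_lt_add (D : Finset (Fin 2 → ℝ)) (t : Fin 2 → ℝ) {b e θ : ℝ}
    (hbe : e - b < Real.pi) (hθ : θ ∈ Set.Icc b e) :
    rankOf D (wvec θ) t < rankOf D (wvec b) t + rankOf D (wvec e) t := by
  have hsub : D.filter (fun s => dotp (wvec θ) s > dotp (wvec θ) t) ⊆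
      D.filter (fun s => dotp (wvec b) s > dotp (wvec b) t) ∪
        D.filter (fun s => dotp (wvec e) s > dotp (wvec e) t) := by
    intro s hs
    rw [← Finset.filter_or]
    obtain ⟨hD, hs⟩ := Finset.mem_filter.1 hs
    exact Finset.mem_filter.2 ⟨hD, dotp_wvec_lt_or_lt hbe hθ hs⟩
  have := (Finset.card_le_card hsub).trans (Finset.card_union_le _ _)
  unfold rankOf
  omega

theorem stmt_12 (D : Finset (Fin 2 → ℝ)) (t : Fin 2 → ℝ) (ht : t ∈ D)
    (k : ℕ) (hk : 0 < k) (hne : (Theta D k t).Nonempty) :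
    IsClosed (Theta D k t) ∧
    ∃ b e : ℝ, IsLeast (Theta D k t) b ∧ IsGreatest (Theta D k t) e ∧
      ∀ θ ∈ Set.Icc b e, rankOf D (wvec θ) t ≤ 2 * k := by
  have hcl := isClosed_Theta D k t
  have hcomp : IsCompact (Theta D k t) :=
    isCompact_Icc.of_isClosed_subset hcl fun _ h => h.1
  obtain ⟨b, hb⟩ := hcomp.exists_isLeast hne
  obtain ⟨e, he⟩ := hcomp.exists_isGreatest hne
  refine ⟨hcl, b, e, hb, he, fun θ hθ => ?_⟩
  have hbe : e - b < Real.pi := by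
    linarith [hb.1.1.1, he.1.1.2, Real.pi_pos]
  have := rankOf_wvec_lt_add D t hbe hθ
  have := hb.1.2
  have := he.1.2
  omega
end
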